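/- arXiv:1505.01012 — 6 statements merged into one kernel-verified Lean document; each statement's English description precedes it below -/
import Mathlib

section
/- Let β ∈ (0,1), let d ≥ 2 and J be natural numbers with 2^J ≥ d, and let φ : ℝ → ℝ be continuously differentiable with support contained in [0,d]. For integers k₁, k₂ with 0 ≤ k₁ ≤ k₂ ≤ 2^J − d, one has B_β(φ_{J,k₁}, φ_{J,k₂}) = (2^{J(2−β)}/Γ(β)) ∫₀ᵈ (∫₀^{x+k₂−k₁} (x + k₂ − k₁ − s)^{β−1} φ′(s) ds) φ′(x) dx. -/
open MeasureTheory intervalIntegral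

/-- The fractional stiffness pairing
`B_β(u,v) = (1/Γ(β)) ∫₀¹ (∫₀ˣ (x−s)^{β−1} u′(s) ds) v′(x) dx`. -/
noncomputable def Bfrac (β : ℝ) (u v : ℝ → ℝ) : ℝ :=
  (1 / Real.Gamma β) *
    ∫ x in (0:ℝ)..1, (∫ s in (0:ℝ)..x, (x - s) ^ (β - 1) * deriv u s) * deriv v x

/-- `φ_{J,k}(x) = 2^{J/2} φ(2^J x − k)`. -/
noncomputable def scaleFn (φ : ℝ → ℝ) (J : ℕ) (k : ℤ) : ℝ → ℝ :=
  fun x => (2:ℝ) ^ ((J : ℝ) / 2) * φ ((2:ℝ) ^ J * x - (k : ℝ))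

lemma deriv_scaleFn (φ : ℝ → ℝ) (J : ℕ) (k : ℤ) (x : ℝ) :
    deriv (scaleFn φ J k) x
      = (2:ℝ) ^ ((J : ℝ) / 2) * 2 ^ J * deriv φ ((2:ℝ) ^ J * x - (k : ℝ)) := by
  have h : deriv (fun y => φ ((2:ℝ) ^ J * y - (k : ℝ))) x
      = (2:ℝ) ^ J * deriv φ ((2:ℝ) ^ J * x - (k : ℝ)) := by
    simpa [deriv_comp_sub_const] using
      deriv_comp_mul_left ((2:ℝ) ^ J) (fun z => φ (z - (k : ℝ))) x
  unfold scaleFn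
  rw [deriv_const_mul_field, h, mul_assoc]

lemma deriv_eq_zero_of_le_of_support_subset {φ : ℝ → ℝ} {a b x : ℝ} (hφ : ContDiff ℝ 1 φ)
    (hsupp : Function.support φ ⊆ Set.Icc a b) (hx : x ≤ a) : deriv φ x = 0 := by
  have hclosed : IsClosed {y | deriv φ y = 0} :=
    isClosed_eq (hφ.continuous_deriv le_rfl) continuous_const
  have hsub : Set.Iio a ⊆ {y | deriv φ y = 0} := by
    intro y hy
    have hloc : φ =ᶠ[nhds y] fun _ => (0:ℝ) := by
      filter_upwards [Iio_mem_nhds hy] with z hz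
      by_contra hne
      exact absurd (hsupp hne).1 (not_le.mpr hz)
    simpa using hloc.deriv_eq
  exact hclosed.closure_subset_iff.mpr hsub (by simpa [closure_Iio] using hx)

lemma deriv_eq_zero_of_lt_of_support_subset {φ : ℝ → ℝ} {a b x : ℝ}
    (hsupp : Function.support φ ⊆ Set.Icc a b) (hx : b < x) : deriv φ x = 0 := by
  have hloc : φ =ᶠ[nhds x] fun _ => (0:ℝ) := by
    filter_upwards [Ioi_mem_nhds hx] with z hz
    by_contra hne
    exact absurd (hsupp hne).2 (not_le.mpr hz)
  simpa using hloc.deriv_eq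

lemma intervalIntegral_eq_of_forall_diff_eq_zero {f : ℝ → ℝ} {a b a' b' : ℝ}
    (ha : a ≤ a') (hab : a' ≤ b') (hb : b' ≤ b)
    (hl : ∀ x, x ≤ a' → f x = 0) (hr : ∀ x ∈ Set.Ioc b' b, f x = 0) :
    ∫ x in a..b, f x = ∫ x in a'..b', f x := by
  rw [integral_of_le (ha.trans (hab.trans hb)), integral_of_le hab]
  refine setIntegral_eq_of_subset_of_forall_sdiff_eq_zero measurableSet_Ioc
    (Set.Ioc_subset_Ioc ha hb) ?_
  rintro x ⟨hx, hx'⟩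
  rcases le_or_gt x a' with h | h
  · exact hl x h
  · exact hr x ⟨not_le.mp fun h' => hx' ⟨h, h'⟩, hx.2⟩

/-- Rescaling of a Riemann–Liouville type integral under the affine map `s ↦ c * s - k`. -/
lemma integral_sub_rpow_comp_mul_sub (g : ℝ → ℝ) (β : ℝ) {c k x : ℝ} (hc : 0 < c) (hx : 0 ≤ x) :
    ∫ s in (0:ℝ)..x, (x - s) ^ (β - 1) * g (c * s - k)
      = c ^ (-β) * ∫ t in (-k)..(c * x - k), (c * x - k - t) ^ (β - 1) * g t := by
  have hpt : ∫ s in (0:ℝ)..x, (x - s) ^ (β - 1) * g (c * s - k)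
      = ∫ s in (0:ℝ)..x, c ^ (1 - β) *
          ((c * x - k - (c * s - k)) ^ (β - 1) * g (c * s - k)) := by
    refine integral_congr fun s hs => ?_
    rw [Set.uIcc_of_le hx] at hs
    have h : c * x - k - (c * s - k) = c * (x - s) := by ring
    have hone : c ^ (1 - β) * c ^ (β - 1) = 1 := by
      rw [← Real.rpow_add hc]; simp
    simp only [h, Real.mul_rpow hc.le (sub_nonneg.mpr hs.2)]
    linear_combination (-(x - s) ^ (β - 1) * g (c * s - k)) * hone
  rw [hpt, intervalIntegral.integral_const_mul,
    integral_comp_mul_sub (fun t => (c * x - k - t) ^ (β - 1) * g t) hc.ne' k, smul_eq_mul,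
    ← mul_assoc, mul_zero, zero_sub]
  congr 1
  rw [← Real.rpow_neg_one c, ← Real.rpow_add hc]
  congr 1
  ring

theorem stmt_1 (β : ℝ) (hβ : β ∈ Set.Ioo (0:ℝ) 1) (d J : ℕ) (hd : 2 ≤ d)
    (hJd : d ≤ 2 ^ J) (φ : ℝ → ℝ) (hφ : ContDiff ℝ 1 φ)
    (hsupp : Function.support φ ⊆ Set.Icc (0:ℝ) (d : ℝ))
    (k₁ k₂ : ℤ)
    (hk₁0 : 0 ≤ k₁) (hk₁₂ : k₁ ≤ k₂) (hk₂1 : k₂ ≤ 2 ^ J - (d : ℤ)) :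
    Bfrac β (scaleFn φ J k₁) (scaleFn φ J k₂)
      = (2:ℝ) ^ ((J : ℝ) * (2 - β)) / Real.Gamma β *
          ∫ x in (0:ℝ)..(d : ℝ),
            (∫ s in (0:ℝ)..(x + (k₂ : ℝ) - (k₁ : ℝ)),
                (x + (k₂ : ℝ) - (k₁ : ℝ) - s) ^ (β - 1) * deriv φ s) * deriv φ x := by
  have h₁ : (0:ℝ) ≤ k₁ := by exact_mod_cast hk₁0
  have h₁₂ : (k₁:ℝ) ≤ k₂ := by exact_mod_cast hk₁₂
  have h₂ : (k₂:ℝ) ≤ 2 ^ J - d := by exact_mod_cast hk₂1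
  have hc : (0:ℝ) < 2 ^ J := by positivity
  have hzero : ∀ x ≤ (0:ℝ), deriv φ x = 0 := fun x hx =>
    deriv_eq_zero_of_le_of_support_subset hφ hsupp hx
  set F : ℝ → ℝ := fun y =>
    (∫ s in (0:ℝ)..(y + (k₂ : ℝ) - (k₁ : ℝ)),
      (y + (k₂ : ℝ) - (k₁ : ℝ) - s) ^ (β - 1) * deriv φ s) * deriv φ y with hF
  set C : ℝ := ((2:ℝ) ^ ((J : ℝ) / 2) * 2 ^ J) ^ 2 * ((2:ℝ) ^ J) ^ (-β) with hC
  have hpt : ∫ x in (0:ℝ)..1, (∫ s in (0:ℝ)..x, (x - s) ^ (β - 1) *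
        deriv (scaleFn φ J k₁) s) * deriv (scaleFn φ J k₂) x
      = ∫ x in (0:ℝ)..1, C * F ((2:ℝ) ^ J * x - k₂) := by
    refine integral_congr fun x hx => ?_
    rw [Set.uIcc_of_le zero_le_one] at hx
    simp only [deriv_scaleFn, hF, mul_left_comm _ ((2:ℝ) ^ ((J : ℝ) / 2) * 2 ^ J) (deriv φ _),
      intervalIntegral.integral_const_mul]
    rcases le_or_gt ((2:ℝ) ^ J * x - k₂) 0 with hy | hy
    · simp [hzero _ hy]
    · rw [integral_sub_rpow_comp_mul_sub (deriv φ) β hc hx.1,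
        intervalIntegral_eq_of_forall_diff_eq_zero (a' := 0) (neg_nonpos.mpr h₁)
          (by linarith) le_rfl (fun t ht => by simp [hzero t ht]) (by simp), sub_add_cancel]
      ring
  have houter : ∫ y in (-(k₂:ℝ))..((2:ℝ) ^ J - k₂), F y = ∫ y in (0:ℝ)..d, F y := by
    refine intervalIntegral_eq_of_forall_diff_eq_zero (by linarith) (Nat.cast_nonneg d)
      (by linarith) (fun y hy => by simp [hF, hzero y hy]) fun y hy => ?_
    simp [hF, deriv_eq_zero_of_lt_of_support_subset hsupp hy.1]
  have hpow : C * ((2:ℝ) ^ J)⁻¹ = (2:ℝ) ^ ((J : ℝ) * (2 - β)) := by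
    have h2 : (0:ℝ) < 2 := two_pos
    rw [hC, ← Real.rpow_natCast 2 J, ← Real.rpow_neg h2.le, ← Real.rpow_mul h2.le,
      ← Real.rpow_add h2, ← Real.rpow_natCast _ 2, ← Real.rpow_mul h2.le, ← Real.rpow_add h2,
      ← Real.rpow_add h2]
    congr 1
    push_cast
    ring
  rw [Bfrac, hpt, intervalIntegral.integral_const_mul, integral_comp_mul_sub F hc.ne', smul_eq_mul,
    mul_zero, zero_sub, mul_one, houter, ← hpow]
  ring
end

section
/- Let β ∈ (0,1) and let u, v : ℝ → ℝ be continuously differentiable. Define the reflections ũ(x) := u(1−x) and ṽ(x) := v(1−x). Then B_β(u, v) = B_β(ṽ, ũ). -/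
open MeasureTheory intervalIntegral

/-- Fubini's theorem for a continuous weight against the Abel kernel on the triangle
`0 < s < x ≤ 1`. -/
theorem integral_abel_kernel_swap {β : ℝ} (hβ : 0 < β) {f g : ℝ → ℝ}
    (hf : Continuous f) (hg : Continuous g) :
    ∫ x in (0:ℝ)..1, (∫ s in (0:ℝ)..x, (x - s) ^ (β - 1) * f s) * g x =
      ∫ s in (0:ℝ)..1, (∫ x in s..1, (x - s) ^ (β - 1) * g x) * f s := by
  set I : Set ℝ := Set.Ioc 0 1 with hI
  set k : ℝ → ℝ := I.indicator fun t => t ^ (β - 1) with hk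
  have hI_meas : MeasurableSet I := measurableSet_Ioc
  have hk_int : Integrable k := by
    rw [hk, integrable_indicator_iff hI_meas, hI,
      ← intervalIntegrable_iff_integrableOn_Ioc_of_le zero_le_one]
    exact intervalIntegrable_rpow' (by linarith)
  have hf_int : Integrable (I.indicator f) := by
    rw [integrable_indicator_iff hI_meas]
    exact hf.integrableOn_Ioc
  obtain ⟨C, hC⟩ := isCompact_Icc.exists_bound_of_continuousOn
    (hg.continuousOn (s := Set.Icc (0:ℝ) 1))
  have hg_bound : ∀ x, ‖I.indicator g x‖ ≤ max C 0 := by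
    intro x
    by_cases hx : x ∈ I
    · rw [Set.indicator_of_mem hx]
      exact (hC x (Set.Ioc_subset_Icc_self hx)).trans (le_max_left _ _)
    · simp [Set.indicator_of_notMem hx]
  have h_int : Integrable
      (Function.uncurry fun x s : ℝ => I.indicator f s * k (x - s) * I.indicator g x)
      ((volume : Measure ℝ).prod volume) := by
    have h := hf_int.convolution_integrand (ContinuousLinearMap.mul ℝ ℝ) hk_int
    refine h.mul_bdd (c := max C 0) ?_ (Filter.Eventually.of_forall fun p => hg_bound p.1)
    exact ((hg.measurable.indicator hI_meas).comp measurable_fst).aestronglyMeasurable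
  have h_swap := integral_integral_swap h_int
  have h_left : ∫ x in (0:ℝ)..1, (∫ s in (0:ℝ)..x, (x - s) ^ (β - 1) * f s) * g x =
      ∫ x, ∫ s, I.indicator f s * k (x - s) * I.indicator g x := by
    rw [integral_of_le zero_le_one, ← MeasureTheory.integral_indicator measurableSet_Ioc]
    congr 1 with x
    rw [MeasureTheory.integral_mul_const]
    by_cases hx : x ∈ I
    · rw [Set.indicator_of_mem hx, Set.indicator_of_mem hx, integral_of_le hx.1.le,
        integral_Ioc_eq_integral_Ioo, ← MeasureTheory.integral_indicator measurableSet_Ioo]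
      congr 2 with s
      simp only [hk, hI, Set.indicator_apply, Set.mem_Ioc, Set.mem_Ioo]
      obtain ⟨h0, h1⟩ := hx
      split_ifs <;> grind
    · rw [Set.indicator_of_notMem hx, Set.indicator_of_notMem hx, mul_zero]
  have h_right : ∫ s in (0:ℝ)..1, (∫ x in s..1, (x - s) ^ (β - 1) * g x) * f s =
      ∫ s, ∫ x, I.indicator f s * k (x - s) * I.indicator g x := by
    rw [integral_of_le zero_le_one, ← MeasureTheory.integral_indicator measurableSet_Ioc]
    congr 1 with s
    simp_rw [mul_assoc]
    rw [MeasureTheory.integral_const_mul, mul_comm]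
    by_cases hs : s ∈ I
    · rw [Set.indicator_of_mem hs, Set.indicator_of_mem hs, integral_of_le hs.2,
        ← MeasureTheory.integral_indicator measurableSet_Ioc]
      congr 2 with x
      simp only [hk, hI, Set.indicator_apply, Set.mem_Ioc]
      obtain ⟨h0, h1⟩ := hs
      split_ifs <;> grind
    · rw [Set.indicator_of_notMem hs, Set.indicator_of_notMem hs, mul_zero]
  rw [h_left, h_right, h_swap]

theorem stmt_2 (β : ℝ) (hβ : β ∈ Set.Ioo (0:ℝ) 1) (u v : ℝ → ℝ)
    (hu : ContDiff ℝ 1 u) (hv : ContDiff ℝ 1 v) :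
    Bfrac β u v = Bfrac β (fun x => v (1 - x)) (fun x => u (1 - x)) := by
  unfold Bfrac
  rw [integral_abel_kernel_swap hβ.1 (hu.continuous_deriv le_rfl) (hv.continuous_deriv le_rfl)]
  congr 1
  have h_reflect := integral_comp_sub_left (a := 0) (b := 1)
    (fun s => (∫ x in s..1, (x - s) ^ (β - 1) * deriv v x) * deriv u s) 1
  rw [sub_self, sub_zero] at h_reflect
  rw [← h_reflect]
  congr 1 with x
  have h_inner := integral_comp_sub_left (a := 0) (b := x)
    (fun y => (y - (1 - x)) ^ (β - 1) * deriv v y) 1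
  rw [sub_zero] at h_inner
  rw [← h_inner]
  simp only [deriv_comp_const_sub, mul_neg, intervalIntegral.integral_neg, neg_mul, neg_neg]
  congr 2 with s
  ring_nf
end

section
/- Let β ∈ (0,1), let d ≥ 2 and J be natural numbers with 2^J ≥ d, and let φ : ℝ → ℝ be continuously differentiable with support contained in [0,d] and symmetric about d/2, i.e., φ(d/2 − x) = φ(d/2 + x) for all x. Let θ : ℝ → ℝ be continuously differentiable with support contained in [0, d_θ] for some real d_θ with 0 < d_θ < d. Set θ_J(x) := 2^{J/2} θ(2^J x) and θ̃_J(x) := 2^{J/2} θ(2^J (1−x)). Then for every integer k with 0 ≤ k ≤ 2^J − d, B_β(θ_J, φ_{J,k}) = B_β(φ_{J, 2^J − d − k}, θ̃_J). -/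
open MeasureTheory intervalIntegral

/-- Exchange of the order of integration for a weakly singular kernel on a triangle. -/
theorem integral_triangle_rpow_swap {β : ℝ} (hβ : β ∈ Set.Ioo (0:ℝ) 1) {f h : ℝ → ℝ}
    (hf : Continuous f) (hh : Continuous h) :
    ∫ x in (0:ℝ)..1, (∫ s in (0:ℝ)..x, (x - s) ^ (β - 1) * f s) * h x
      = ∫ s in (0:ℝ)..1, (∫ x in s..1, (x - s) ^ (β - 1) * h x) * f s := by
  obtain ⟨hβ0, hβ1⟩ := hβ
  set I : Set ℝ := Set.Ioc (0:ℝ) 1 with hI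
  set F : ℝ → ℝ := I.indicator f with hF
  set H : ℝ → ℝ := I.indicator h with hH
  set g : ℝ → ℝ := I.indicator (fun t => t ^ (β - 1)) with hg
  have hgi : Integrable g := by
    rw [hg, integrable_indicator_iff measurableSet_Ioc,
      ← intervalIntegrable_iff_integrableOn_Ioc_of_le zero_le_one]
    exact intervalIntegrable_rpow' (by linarith)
  have hFi : Integrable F := by
    rw [hF, integrable_indicator_iff measurableSet_Ioc]
    exact hf.integrableOn_Ioc
  have hconv : Integrable (fun p : ℝ × ℝ => F p.2 * g (p.1 - p.2)) (volume.prod volume) :=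
    hFi.convolution_integrand (ContinuousLinearMap.mul ℝ ℝ) hgi
  obtain ⟨C, hC⟩ := (isCompact_Icc (a := (0:ℝ)) (b := 1)).exists_bound_of_continuousOn
    hh.continuousOn
  have hHb : ∀ x, ‖H x‖ ≤ C := by
    intro x
    by_cases hx : x ∈ I
    · rw [hH, Set.indicator_of_mem hx]
      exact hC x (Set.Ioc_subset_Icc_self hx)
    · rw [hH, Set.indicator_of_notMem hx, norm_zero]
      exact (norm_nonneg _).trans (hC 0 ⟨le_rfl, zero_le_one⟩)
  have hHm : Measurable H := hh.measurable.indicator measurableSet_Ioc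
  have hint : Integrable (fun p : ℝ × ℝ => H p.1 * (F p.2 * g (p.1 - p.2)))
      (volume.prod volume) :=
    hconv.bdd_mul (c := C) (hHm.comp measurable_fst).aestronglyMeasurable
      (Filter.Eventually.of_forall fun p => hHb p.1)
  have hswap := integral_integral_swap
    (f := fun x s : ℝ => H x * (F s * g (x - s))) hint
  have hzero : (0:ℝ) ^ (β - 1) = 0 := Real.zero_rpow (by linarith)
  have hleft : ∫ x in (0:ℝ)..1, (∫ s in (0:ℝ)..x, (x - s) ^ (β - 1) * f s) * h x
      = ∫ x, ∫ s, H x * (F s * g (x - s)) := by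
    rw [intervalIntegral.integral_of_le zero_le_one,
      ← MeasureTheory.integral_indicator measurableSet_Ioc]
    congr 1
    ext x
    rw [MeasureTheory.integral_const_mul]
    by_cases hx : x ∈ I
    · rw [Set.indicator_of_mem hx, hH, Set.indicator_of_mem hx, mul_comm,
        intervalIntegral.integral_of_le hx.1.le,
        ← MeasureTheory.integral_indicator measurableSet_Ioc]
      congr 2
      ext s
      by_cases hs : s ∈ Set.Ioc 0 x
      · rw [Set.indicator_of_mem hs, hF, Set.indicator_of_mem (show s ∈ I from ⟨hs.1, hs.2.trans hx.2⟩), mul_comm]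
        rcases hs.2.eq_or_lt with rfl | hlt
        · simp [hg, hI, hzero]
        · rw [hg, Set.indicator_of_mem
            (show x - s ∈ I from ⟨by linarith, by linarith [hx.2, hs.1]⟩)]
      · rw [Set.indicator_of_notMem hs]
        by_cases hs0 : 0 < s
        · have : x - s ∉ I := fun hm => hs ⟨hs0, by linarith [hm.1]⟩
          rw [hg, Set.indicator_of_notMem this, mul_zero]
        · have : s ∉ I := fun hm => hs0 hm.1
          rw [hF, Set.indicator_of_notMem this, zero_mul]
    · rw [Set.indicator_of_notMem hx, hH, Set.indicator_of_notMem hx, zero_mul]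
  have hright : ∫ s in (0:ℝ)..1, (∫ x in s..1, (x - s) ^ (β - 1) * h x) * f s
      = ∫ s, ∫ x, H x * (F s * g (x - s)) := by
    rw [intervalIntegral.integral_of_le zero_le_one,
      ← MeasureTheory.integral_indicator measurableSet_Ioc]
    congr 1
    ext s
    simp_rw [mul_left_comm (H _) (F s)]
    rw [MeasureTheory.integral_const_mul]
    by_cases hs : s ∈ I
    · rw [Set.indicator_of_mem hs, hF, Set.indicator_of_mem hs, mul_comm,
        intervalIntegral.integral_of_le hs.2,
        ← MeasureTheory.integral_indicator measurableSet_Ioc]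
      congr 2
      ext x
      by_cases hx : x ∈ Set.Ioc s 1
      · rw [Set.indicator_of_mem hx, hH, Set.indicator_of_mem (show x ∈ I from ⟨hs.1.trans hx.1, hx.2⟩), hg,
          Set.indicator_of_mem
            (show x - s ∈ I from ⟨by linarith [hx.1], by linarith [hx.2, hs.1]⟩), mul_comm]
      · rw [Set.indicator_of_notMem hx]
        by_cases hx1 : x ≤ 1
        · have : x - s ∉ I := fun hm => hx ⟨by linarith [hm.1], hx1⟩
          rw [hg, Set.indicator_of_notMem this, mul_zero]
        · have : x ∉ I := fun hm => hx1 hm.2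
          rw [hH, Set.indicator_of_notMem this, zero_mul]
    · rw [Set.indicator_of_notMem hs, hF, Set.indicator_of_notMem hs, zero_mul]
  rw [hleft, hright, hswap]

/-- Reflecting both arguments about `1/2` and exchanging them preserves the pairing. -/
theorem Bfrac_reflect_swap {β : ℝ} (hβ : β ∈ Set.Ioo (0:ℝ) 1) {u v : ℝ → ℝ}
    (hu : ContDiff ℝ 1 u) (hv : ContDiff ℝ 1 v) :
    Bfrac β u v = Bfrac β (fun x => v (1 - x)) (fun x => u (1 - x)) := by
  unfold Bfrac
  rw [integral_triangle_rpow_swap hβ (hu.continuous_deriv le_rfl) (hv.continuous_deriv le_rfl)]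
  congr 1
  simp only [deriv_comp_const_sub, mul_neg, intervalIntegral.integral_neg, neg_mul, neg_neg]
  have houter := intervalIntegral.integral_comp_sub_left (a := 0) (b := 1)
    (fun y => (∫ x in y..1, (x - y) ^ (β - 1) * deriv v x) * deriv u y) 1
  rw [sub_self, sub_zero] at houter
  rw [← houter]
  congr 1
  ext x
  congr 1
  have hinner := intervalIntegral.integral_comp_sub_left (a := 0) (b := x)
    (fun t => (t - (1 - x)) ^ (β - 1) * deriv v t) 1
  rw [sub_zero] at hinner
  rw [← hinner]
  congr 1
  ext s
  congr 2
  ring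

theorem stmt_3 (β : ℝ) (hβ : β ∈ Set.Ioo (0:ℝ) 1) (d J : ℕ) (hd : 2 ≤ d)
    (hJd : d ≤ 2 ^ J) (φ : ℝ → ℝ) (hφ : ContDiff ℝ 1 φ)
    (hsupp : Function.support φ ⊆ Set.Icc (0:ℝ) (d : ℝ))
    (hsym : ∀ x : ℝ, φ ((d : ℝ) / 2 - x) = φ ((d : ℝ) / 2 + x))
    (θ : ℝ → ℝ) (hθ : ContDiff ℝ 1 θ) (dθ : ℝ) (hdθ0 : 0 < dθ) (hdθd : dθ < (d : ℝ))
    (hθsupp : Function.support θ ⊆ Set.Icc (0:ℝ) dθ)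
    (k : ℤ) (hk0 : 0 ≤ k) (hk1 : k ≤ 2 ^ J - (d : ℤ)) :
    Bfrac β (fun x => (2:ℝ) ^ ((J : ℝ) / 2) * θ ((2:ℝ) ^ J * x)) (scaleFn φ J k)
      = Bfrac β (scaleFn φ J (2 ^ J - (d : ℤ) - k))
          (fun x => (2:ℝ) ^ ((J : ℝ) / 2) * θ ((2:ℝ) ^ J * (1 - x))) := by
  have hv : ContDiff ℝ 1 (scaleFn φ J k) := by
    unfold scaleFn
    fun_prop
  rw [Bfrac_reflect_swap hβ (by fun_prop) hv]
  congr 1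
  ext x
  have hx := hsym ((d : ℝ) / 2 - ((2:ℝ) ^ J * (1 - x) - k))
  rw [sub_sub_cancel] at hx
  simp only [scaleFn]
  rw [hx]
  congr 2
  push_cast
  ring
end

section
/- Let β ∈ (0,1) and let w, z : ℝ → ℝ be continuous on [0,1]. Then the order-β left fractional integral pairing splits into half-order left and right fractional integrals: (1/Γ(β)) ∫₀¹ (∫₀ˣ (x−s)^{β−1} w(s) ds) z(x) dx = ∫₀¹ [ (1/Γ(β/2)) ∫₀ˣ (x−s)^{β/2−1} w(s) ds ] · [ (1/Γ(β/2)) ∫ₓ¹ (s−x)^{β/2−1} z(s) ds ] dx. -/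
open MeasureTheory intervalIntegral

/-- The kernel `t ^ (c - 1)` of fractional integration of order `c`, truncated to `(0, 1]`. -/
noncomputable def fracKernel (c : ℝ) : ℝ → ℝ :=
  (Set.Ioc (0:ℝ) 1).indicator fun t => t ^ (c - 1)

lemma fracKernel_of_mem {c t : ℝ} (ht : t ∈ Set.Ioc (0:ℝ) 1) : fracKernel c t = t ^ (c - 1) :=
  Set.indicator_of_mem ht _

lemma fracKernel_of_nonpos {c t : ℝ} (ht : t ≤ 0) : fracKernel c t = 0 :=
  Set.indicator_of_notMem (fun h => not_lt.2 ht h.1) _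

lemma fracKernel_of_mem_Icc {c t : ℝ} (hc : c < 1) (ht : t ∈ Set.Icc (0:ℝ) 1) :
    fracKernel c t = t ^ (c - 1) := by
  rcases ht.1.eq_or_lt with h | h
  · rw [fracKernel_of_nonpos h.ge, ← h, Real.zero_rpow (by linarith)]
  · exact fracKernel_of_mem ⟨h, ht.2⟩

lemma integrable_fracKernel {c : ℝ} (hc : 0 < c) : Integrable (fracKernel c) := by
  have h := intervalIntegrable_rpow' (a := 0) (b := 1) (r := c - 1) (by linarith)
  rw [intervalIntegrable_iff_integrableOn_Ioc_of_le zero_le_one] at h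
  exact h.integrable_indicator measurableSet_Ioc

/-- The real Beta integral over an interval `(0, d)`. -/
lemma integral_rpow_mul_sub_rpow {a b d : ℝ} (ha : 0 < a) (hb : 0 < b) (hd : 0 < d) :
    ∫ u in (0:ℝ)..d, u ^ (a - 1) * (d - u) ^ (b - 1)
      = d ^ (a + b - 1) * ProbabilityTheory.beta a b := by
  have hbeta : Complex.betaIntegral a b = (ProbabilityTheory.beta a b : ℂ) := by
    rw [Complex.betaIntegral_eq_Gamma_mul_div _ _ (by simpa) (by simpa), ProbabilityTheory.beta]
    push_cast [← Complex.Gamma_ofReal]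
    rfl
  have h := Complex.betaIntegral_scaled a b hd
  rw [hbeta] at h
  apply Complex.ofReal_injective
  rw [← intervalIntegral.integral_ofReal]
  push_cast [Complex.ofReal_cpow hd.le]
  rw [← h]
  refine intervalIntegral.integral_congr fun u hu => ?_
  rw [Set.uIcc_of_le hd.le] at hu
  push_cast [Complex.ofReal_cpow hu.1, Complex.ofReal_cpow (sub_nonneg.2 hu.2)]
  rfl

lemma integral_fracKernel_mul_fracKernel {a b s t : ℝ} (ha : 0 < a) (hb : 0 < b) (hb' : b < 1)
    (hst : t - s ≤ 1) :
    ∫ x, fracKernel a (x - s) * fracKernel b (t - x)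
      = ProbabilityTheory.beta a b * fracKernel (a + b) (t - s) := by
  rw [← integral_add_right_eq_self _ s]
  rcases le_or_gt (t - s) 0 with hd | hd
  · rw [fracKernel_of_nonpos hd, mul_zero]
    refine integral_eq_zero_of_ae (.of_forall fun x => ?_)
    rcases le_or_gt x 0 with hx | hx
    · simp [fracKernel_of_nonpos hx]
    · simp [fracKernel_of_nonpos (show t - (x + s) ≤ 0 by linarith)]
  · rw [fracKernel_of_mem ⟨hd, hst⟩, mul_comm, ← integral_rpow_mul_sub_rpow ha hb hd,
      integral_of_le hd.le, ← MeasureTheory.integral_indicator measurableSet_Ioc]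
    refine integral_congr_ae (.of_forall fun x => ?_)
    by_cases hx : x ∈ Set.Ioc 0 (t - s)
    · rw [Set.indicator_of_mem hx]
      obtain ⟨hx0, hx1⟩ := hx
      simp only [add_sub_cancel_right]
      rw [fracKernel_of_mem ⟨hx0, by linarith⟩,
        fracKernel_of_mem_Icc hb' ⟨by linarith, by linarith⟩, sub_sub, add_comm x s]
    · rw [Set.indicator_of_notMem hx]
      simp only [add_sub_cancel_right]
      rcases le_or_gt x 0 with h | h
      · simp [fracKernel_of_nonpos h]
      · have : t - (x + s) ≤ 0 := by
          by_contra! h'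
          exact hx ⟨h, by linarith⟩
        simp [fracKernel_of_nonpos this]

/-- Fubini for a pairing of two convolutions, one against a kernel and one against a reflected
kernel. -/
lemma integral_convolution_mul_convolution {k l w z : ℝ → ℝ} {C D : ℝ} (hk : Integrable k)
    (hl : Integrable l) (hw : Integrable w) (hz : Integrable z)
    (hwC : ∀ s, ‖w s‖ ≤ C) (hzD : ∀ t, ‖z t‖ ≤ D) :
    ∫ x, (∫ s, k (x - s) * w s) * ∫ t, l (t - x) * z t
      = ∫ t, (∫ s, (∫ x, k (x - s) * l (t - x)) * w s) * z t := by
  have hA : Integrable fun x => ∫ s, k (x - s) * w s := by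
    simpa [mul_comm] using
      (hw.convolution_integrand (ContinuousLinearMap.mul ℝ ℝ) hk).integral_prod_left
  have hswap : Integrable (Function.uncurry fun x t =>
      (∫ s, k (x - s) * w s) * (l (t - x) * z t)) (volume.prod volume) := by
    have h := (hA.convolution_integrand (ContinuousLinearMap.mul ℝ ℝ) hl).swap
    refine (h.mul_bdd (hz.aestronglyMeasurable.comp_snd) (.of_forall fun p => hzD p.2)).congr
      (.of_forall fun p => ?_)
    simp [Function.uncurry, mul_assoc]
  simp_rw [← MeasureTheory.integral_const_mul]
  rw [integral_integral_swap hswap]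
  refine integral_congr_ae (.of_forall fun t => ?_)
  have hswap' : Integrable (Function.uncurry fun x s => k (x - s) * l (t - x) * w s)
      (volume.prod volume) := by
    have h := ((hl.comp_sub_left t).convolution_integrand (ContinuousLinearMap.mul ℝ ℝ)
      hk.comp_neg).swap
    refine (h.mul_bdd (hw.aestronglyMeasurable.comp_snd) (.of_forall fun p => hwC p.2)).congr
      (.of_forall fun p => ?_)
    simp [Function.uncurry, mul_comm]
  simp only
  simp_rw [← mul_assoc, MeasureTheory.integral_mul_const, ← MeasureTheory.integral_mul_const (w _)]
  rw [← integral_integral_swap hswap']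
  congr 1
  refine integral_congr_ae (.of_forall fun x => ?_)
  simp only
  rw [← MeasureTheory.integral_mul_const]
  refine integral_congr_ae (.of_forall fun s => ?_)
  simp only
  ring

lemma fracKernel_left_integral {c x : ℝ} (hc : c < 1) (hx : x ∈ Set.Ioc (0:ℝ) 1) (w : ℝ → ℝ) :
    ∫ s in (0:ℝ)..x, (x - s) ^ (c - 1) * w s
      = ∫ s, fracKernel c (x - s) * (Set.Ioc (0:ℝ) 1).indicator w s := by
  rw [integral_of_le hx.1.le, ← MeasureTheory.integral_indicator measurableSet_Ioc]
  refine integral_congr_ae (.of_forall fun s => ?_)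
  by_cases hs : s ∈ Set.Ioc 0 x
  · simp only [Set.indicator_of_mem hs]
    rw [Set.indicator_of_mem (Set.mem_Ioc.2 ⟨hs.1, hs.2.trans hx.2⟩),
      fracKernel_of_mem_Icc hc ⟨by linarith [hs.2], by linarith [hs.1, hx.2]⟩]
  · simp only [Set.indicator_of_notMem hs]
    rcases le_or_gt s 0 with h | h
    · rw [Set.indicator_of_notMem (fun h' => not_lt.2 h h'.1), mul_zero]
    · have : x - s ≤ 0 := by
        by_contra! h'
        exact hs ⟨h, by linarith⟩
      rw [fracKernel_of_nonpos this, zero_mul]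

lemma fracKernel_right_integral {c x : ℝ} (hx : x ∈ Set.Ioc (0:ℝ) 1) (z : ℝ → ℝ) :
    ∫ s in x..(1:ℝ), (s - x) ^ (c - 1) * z s
      = ∫ s, fracKernel c (s - x) * (Set.Ioc (0:ℝ) 1).indicator z s := by
  rw [integral_of_le hx.2, ← MeasureTheory.integral_indicator measurableSet_Ioc]
  refine integral_congr_ae (.of_forall fun s => ?_)
  by_cases hs : s ∈ Set.Ioc x 1
  · simp only [Set.indicator_of_mem hs]
    rw [Set.indicator_of_mem (Set.mem_Ioc.2 ⟨hx.1.trans hs.1, hs.2⟩),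
      fracKernel_of_mem ⟨by linarith [hs.1], by linarith [hs.2, hx.1]⟩]
  · simp only [Set.indicator_of_notMem hs]
    rcases le_or_gt s x with h | h
    · rw [fracKernel_of_nonpos (by linarith), zero_mul]
    · rw [Set.indicator_of_notMem (fun h' => hs ⟨h, h'.2⟩), mul_zero]

lemma ContinuousOn.integrable_indicator_Ioc {w : ℝ → ℝ} {a b : ℝ}
    (hw : ContinuousOn w (Set.Icc a b)) : Integrable ((Set.Ioc a b).indicator w) :=
  (hw.integrableOn_Icc.mono_set Set.Ioc_subset_Icc_self).integrable_indicator measurableSet_Ioc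

lemma ContinuousOn.exists_bound_indicator_Ioc {w : ℝ → ℝ} {a b : ℝ}
    (hw : ContinuousOn w (Set.Icc a b)) : ∃ C, ∀ s, ‖(Set.Ioc a b).indicator w s‖ ≤ C := by
  obtain ⟨C, hC⟩ := isCompact_Icc.exists_bound_of_continuousOn hw
  refine ⟨max C 0, fun s => ?_⟩
  by_cases hs : s ∈ Set.Ioc a b
  · rw [Set.indicator_of_mem hs]
    exact (hC s (Set.Ioc_subset_Icc_self hs)).trans (le_max_left _ _)
  · rw [Set.indicator_of_notMem hs, norm_zero]
    exact le_max_right _ _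

lemma integral_left_mul_right {a b : ℝ} (ha : a ∈ Set.Ioo (0:ℝ) 1) (hb : b ∈ Set.Ioo (0:ℝ) 1)
    (hab : a + b < 1) {w z : ℝ → ℝ}
    (hw : ContinuousOn w (Set.Icc (0:ℝ) 1)) (hz : ContinuousOn z (Set.Icc (0:ℝ) 1)) :
    ∫ x in (0:ℝ)..1, (∫ s in (0:ℝ)..x, (x - s) ^ (a - 1) * w s) *
        ∫ s in x..(1:ℝ), (s - x) ^ (b - 1) * z s
      = ProbabilityTheory.beta a b *
        ∫ x in (0:ℝ)..1, (∫ s in (0:ℝ)..x, (x - s) ^ (a + b - 1) * w s) * z x := by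
  obtain ⟨C, hC⟩ := hw.exists_bound_indicator_Ioc
  obtain ⟨D, hD⟩ := hz.exists_bound_indicator_Ioc
  have key := integral_convolution_mul_convolution (integrable_fracKernel ha.1)
    (integrable_fracKernel hb.1) hw.integrable_indicator_Ioc hz.integrable_indicator_Ioc hC hD
  rw [integral_of_le zero_le_one, integral_of_le zero_le_one,
    ← MeasureTheory.integral_indicator measurableSet_Ioc, ← MeasureTheory.integral_indicator measurableSet_Ioc,
    ← MeasureTheory.integral_const_mul]
  refine Eq.trans (integral_congr_ae (.of_forall fun x => ?_))
    (key.trans (integral_congr_ae (.of_forall fun t => ?_)))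
  · by_cases hx : x ∈ Set.Ioc (0:ℝ) 1
    · simp only [Set.indicator_of_mem hx]
      rw [fracKernel_left_integral ha.2 hx, fracKernel_right_integral hx]
    · simp only [Set.indicator_of_notMem hx]
      symm
      rcases le_or_gt x 0 with h | h
      · refine mul_eq_zero_of_left (integral_eq_zero_of_ae (.of_forall fun s => ?_)) _
        rcases le_or_gt s 0 with hs | hs
        · simp [Set.indicator_of_notMem (fun h' : s ∈ Set.Ioc (0:ℝ) 1 => not_lt.2 hs h'.1)]
        · simp [fracKernel_of_nonpos (show x - s ≤ 0 by linarith)]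
      · refine mul_eq_zero_of_right _ (integral_eq_zero_of_ae (.of_forall fun s => ?_))
        rcases le_or_gt s 1 with hs | hs
        · have : 1 < x := by
            by_contra! h'
            exact hx ⟨h, h'⟩
          simp [fracKernel_of_nonpos (show s - x ≤ 0 by linarith)]
        · simp [Set.indicator_of_notMem (fun h' : s ∈ Set.Ioc (0:ℝ) 1 => not_lt.2 h'.2 hs)]
  · by_cases ht : t ∈ Set.Ioc (0:ℝ) 1
    · simp only [Set.indicator_of_mem ht]
      rw [fracKernel_left_integral hab ht, ← mul_assoc, ← MeasureTheory.integral_const_mul]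
      congr 1
      refine integral_congr_ae (.of_forall fun s => ?_)
      simp only
      by_cases hs : s ∈ Set.Ioc (0:ℝ) 1
      · rw [integral_fracKernel_mul_fracKernel ha.1 hb.1 hb.2 (by linarith [ht.2, hs.1]),
          mul_assoc]
      · simp [Set.indicator_of_notMem hs]
    · simp [Set.indicator_of_notMem ht]

theorem stmt_7 (β : ℝ) (hβ : β ∈ Set.Ioo (0:ℝ) 1) (w z : ℝ → ℝ)
    (hw : ContinuousOn w (Set.Icc (0:ℝ) 1)) (hz : ContinuousOn z (Set.Icc (0:ℝ) 1)) :
    (1 / Real.Gamma β) * ∫ x in (0:ℝ)..1, (∫ s in (0:ℝ)..x, (x - s) ^ (β - 1) * w s) * z x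
      = ∫ x in (0:ℝ)..1,
          ((1 / Real.Gamma (β / 2)) * ∫ s in (0:ℝ)..x, (x - s) ^ (β / 2 - 1) * w s) *
            ((1 / Real.Gamma (β / 2)) * ∫ s in x..(1:ℝ), (s - x) ^ (β / 2 - 1) * z s) := by
  obtain ⟨h0, h1⟩ := hβ
  have hβ2 : β / 2 ∈ Set.Ioo (0:ℝ) 1 := ⟨by linarith, by linarith⟩
  have h := integral_left_mul_right hβ2 hβ2 (by linarith) hw hz
  rw [add_halves] at h
  simp_rw [mul_mul_mul_comm (1 / Real.Gamma (β / 2))]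
  rw [intervalIntegral.integral_const_mul, h, ProbabilityTheory.beta, add_halves]
  have := (Real.Gamma_pos_of_pos hβ2.1).ne'
  have := (Real.Gamma_pos_of_pos h0).ne'
  field_simp
end

section
/- Let H be a real inner product space, let a : H × H → ℝ be a bilinear form, and let C, c > 0 satisfy |a(u,v)| ≤ C‖u‖‖v‖ and a(u,u) ≥ c‖u‖² for all u, v ∈ H (continuity and coercivity). Let N ≥ 1, let w : Fin N → H, and let c₁, c₂ > 0 be such that the Riesz stability c₁‖x‖² ≤ ‖Σᵢ xᵢ wᵢ‖² ≤ c₂‖x‖² holds for all x ∈ ℝᴺ (Euclidean norm). Let G be the N × N real matrix with entries Gᵢⱼ = a(wⱼ, wᵢ). Then c·c₁·‖x‖ ≤ ‖Gx‖ ≤ C·c₂·‖x‖ for all x ∈ ℝᴺ; in particular G is invertible, ‖G‖ ≤ C·c₂, ‖G⁻¹‖ ≤ 1/(c·c₁), and the spectral condition number ‖G‖·‖G⁻¹‖ is at most (C·c₂)/(c·c₁), independently of N. -/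
open Matrix

open scoped RealInnerProductSpace in
/-- The Galerkin matrix of `a` in the family `w` represents `a` on the span of `w`. -/
theorem inner_toEuclideanCLM_eq {H ι : Type*} [AddCommGroup H] [Module ℝ H]
    [Fintype ι] [DecidableEq ι] (a : H →ₗ[ℝ] H →ₗ[ℝ] ℝ) (w : ι → H) (G : Matrix ι ι ℝ)
    (hG : ∀ i j, G i j = a (w j) (w i)) (x y : EuclideanSpace ℝ ι) :
    ⟪y, Matrix.toEuclideanCLM (𝕜 := ℝ) G x⟫ = a (∑ j, x j • w j) (∑ i, y i • w i) := by
  simp only [PiLp.inner_apply, Matrix.ofLp_toEuclideanCLM, Matrix.mulVec, dotProduct, hG,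
    map_sum, map_smul, LinearMap.sum_apply, LinearMap.smul_apply, smul_eq_mul,
    RCLike.inner_apply, conj_trivial, Finset.sum_mul, Finset.mul_sum]
  refine Finset.sum_congr rfl fun i _ => Finset.sum_congr rfl fun j _ => ?_
  ring

/-- A square matrix that is bounded below in the Euclidean norm is invertible. -/
theorem Matrix.isUnit_of_mul_norm_le {ι : Type*} [Fintype ι] [DecidableEq ι]
    {G : Matrix ι ι ℝ} {m : ℝ} (hm : 0 < m)
    (h : ∀ x : EuclideanSpace ℝ ι, m * ‖x‖ ≤ ‖Matrix.toEuclideanCLM (𝕜 := ℝ) G x‖) :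
    IsUnit G := by
  rw [← Matrix.mulVec_injective_iff_isUnit, ← Matrix.coe_mulVecLin, ← LinearMap.ker_eq_bot,
    LinearMap.ker_eq_bot']
  intro v hv
  have hx := h (WithLp.toLp 2 v)
  rw [Matrix.toEuclideanCLM_toLp, ← Matrix.mulVecLin_apply, hv, WithLp.toLp_zero, norm_zero] at hx
  have hv0 : ‖WithLp.toLp 2 v‖ = 0 :=
    le_antisymm (nonpos_of_mul_nonpos_right hx hm) (norm_nonneg _)
  simpa using hv0

/-- A lower bound for a matrix in the Euclidean norm bounds the norm of its inverse. -/
theorem Matrix.norm_toEuclideanCLM_inv_le {ι : Type*} [Fintype ι] [DecidableEq ι]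
    {G : Matrix ι ι ℝ} {m : ℝ} (hm : 0 < m)
    (h : ∀ x : EuclideanSpace ℝ ι, m * ‖x‖ ≤ ‖Matrix.toEuclideanCLM (𝕜 := ℝ) G x‖) :
    ‖(Matrix.toEuclideanCLM (𝕜 := ℝ) G⁻¹ :
      EuclideanSpace ℝ ι →L[ℝ] EuclideanSpace ℝ ι)‖ ≤ 1 / m := by
  refine ContinuousLinearMap.opNorm_le_bound _ (by positivity) fun x => ?_
  have hdet := (Matrix.isUnit_iff_isUnit_det G).1 (Matrix.isUnit_of_mul_norm_le hm h)
  have hx := h (Matrix.toEuclideanCLM (𝕜 := ℝ) G⁻¹ x)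
  rw [← mul_apply_eq_comp, ← map_mul, Matrix.mul_nonsing_inv G hdet, map_one,
    one_apply_eq_self] at hx
  rw [one_div_mul_eq_div, le_div_iff₀' hm]
  exact hx

theorem stmt_9 {H : Type*} [NormedAddCommGroup H] [InnerProductSpace ℝ H]
    (a : H →ₗ[ℝ] H →ₗ[ℝ] ℝ) (C c : ℝ) (hC : 0 < C) (hc : 0 < c)
    (hcont : ∀ u v : H, |a u v| ≤ C * ‖u‖ * ‖v‖)
    (hcoer : ∀ u : H, c * ‖u‖ ^ 2 ≤ a u u)
    (N : ℕ) (hN : 1 ≤ N) (w : Fin N → H) (c₁ c₂ : ℝ) (hc₁ : 0 < c₁) (hc₂ : 0 < c₂)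
    (hriesz : ∀ x : EuclideanSpace ℝ (Fin N),
      c₁ * ‖x‖ ^ 2 ≤ ‖∑ i, x i • w i‖ ^ 2 ∧ ‖∑ i, x i • w i‖ ^ 2 ≤ c₂ * ‖x‖ ^ 2)
    (G : Matrix (Fin N) (Fin N) ℝ) (hG : ∀ i j, G i j = a (w j) (w i)) :
    (∀ x : EuclideanSpace ℝ (Fin N),
        c * c₁ * ‖x‖ ≤ ‖(Matrix.toEuclideanCLM (𝕜 := ℝ) G) x‖ ∧
          ‖(Matrix.toEuclideanCLM (𝕜 := ℝ) G) x‖ ≤ C * c₂ * ‖x‖) ∧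
      IsUnit G ∧
      ‖(Matrix.toEuclideanCLM (𝕜 := ℝ) G :
          EuclideanSpace ℝ (Fin N) →L[ℝ] EuclideanSpace ℝ (Fin N))‖ ≤ C * c₂ ∧
      ‖(Matrix.toEuclideanCLM (𝕜 := ℝ) G⁻¹ :
          EuclideanSpace ℝ (Fin N) →L[ℝ] EuclideanSpace ℝ (Fin N))‖ ≤ 1 / (c * c₁) ∧
      ‖(Matrix.toEuclideanCLM (𝕜 := ℝ) G :
          EuclideanSpace ℝ (Fin N) →L[ℝ] EuclideanSpace ℝ (Fin N))‖ *
        ‖(Matrix.toEuclideanCLM (𝕜 := ℝ) G⁻¹ :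
          EuclideanSpace ℝ (Fin N) →L[ℝ] EuclideanSpace ℝ (Fin N))‖ ≤ (C * c₂) / (c * c₁) := by
  have key := inner_toEuclideanCLM_eq a w G hG
  have lower : ∀ x : EuclideanSpace ℝ (Fin N),
      c * c₁ * ‖x‖ ≤ ‖(Matrix.toEuclideanCLM (𝕜 := ℝ) G) x‖ := by
    intro x
    rcases (norm_nonneg x).eq_or_lt with hx | hx
    · simp [← hx]
    refine le_of_mul_le_mul_left ?_ hx
    calc ‖x‖ * (c * c₁ * ‖x‖) = c * (c₁ * ‖x‖ ^ 2) := by ring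
      _ ≤ c * ‖∑ i, x i • w i‖ ^ 2 := by gcongr; exact (hriesz x).1
      _ ≤ a (∑ i, x i • w i) (∑ i, x i • w i) := hcoer _
      _ = inner ℝ x (Matrix.toEuclideanCLM (𝕜 := ℝ) G x) := (key x x).symm
      _ ≤ ‖x‖ * ‖Matrix.toEuclideanCLM (𝕜 := ℝ) G x‖ := real_inner_le_norm _ _
  have synth : ∀ x : EuclideanSpace ℝ (Fin N), ‖∑ i, x i • w i‖ ≤ √c₂ * ‖x‖ := by
    intro x
    refine le_of_sq_le_sq ?_ (by positivity)
    rw [mul_pow, Real.sq_sqrt hc₂.le]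
    exact (hriesz x).2
  have upper : ∀ x : EuclideanSpace ℝ (Fin N),
      ‖(Matrix.toEuclideanCLM (𝕜 := ℝ) G) x‖ ≤ C * c₂ * ‖x‖ := by
    intro x
    set y := Matrix.toEuclideanCLM (𝕜 := ℝ) G x with hy
    rcases (norm_nonneg y).eq_or_lt with hy0 | hy0
    · rw [← hy0]; positivity
    refine le_of_mul_le_mul_left ?_ hy0
    calc ‖y‖ * ‖y‖ = inner ℝ y y := (real_inner_self_eq_norm_mul_norm y).symm
      _ = a (∑ i, x i • w i) (∑ i, y i • w i) := key x y
      _ ≤ C * ‖∑ i, x i • w i‖ * ‖∑ i, y i • w i‖ := (le_abs_self _).trans (hcont _ _)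
      _ ≤ C * (√c₂ * ‖x‖) * (√c₂ * ‖y‖) := by gcongr <;> exact synth _
      _ = C * (√c₂ * √c₂) * ‖x‖ * ‖y‖ := by ring
      _ = ‖y‖ * (C * c₂ * ‖x‖) := by rw [Real.mul_self_sqrt hc₂.le]; ring
  have hm : 0 < c * c₁ := mul_pos hc hc₁
  have hM : 0 ≤ C * c₂ := (mul_pos hC hc₂).le
  have hnorm := ContinuousLinearMap.opNorm_le_bound (Matrix.toEuclideanCLM (𝕜 := ℝ) G) hM upper
  have hinv := Matrix.norm_toEuclideanCLM_inv_le hm lower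
  refine ⟨fun x => ⟨lower x, upper x⟩, Matrix.isUnit_of_mul_norm_le hm lower, hnorm, hinv, ?_⟩
  rw [div_eq_mul_one_div]
  exact mul_le_mul hnorm hinv (norm_nonneg _) hM
end

section
/- Let β ∈ (0,1) and let φ : ℝ → ℝ be the cubic B-spline φ(x) := (1/6) Σ_{i=0}^{4} C(4,i) (−1)ⁱ (x−i)₊³, where C(4,i) is the binomial coefficient and t₊ := max(t,0). Then for every x > 0, the function F(x) := (1/Γ(β)) ∫₀ˣ (x−s)^{β−1} φ(s) ds is differentiable at x with F′(x) = (1/Γ(β+3)) Σ_{i=0}^{4} C(4,i) (−1)ⁱ (x−i)₊^{β+2}. -/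
open MeasureTheory intervalIntegral

theorem hasDerivAt_max_zero_rpow {p : ℝ} (hp : 1 < p) (x : ℝ) :
    HasDerivAt (fun y : ℝ => (max y 0) ^ p) (p * (max x 0) ^ (p - 1)) x := by
  have hp0 : p ≠ 0 := by linarith
  have hp1 : p - 1 ≠ 0 := by linarith
  rcases lt_trichotomy x 0 with hx | rfl | hx
  · rw [max_eq_right hx.le, Real.zero_rpow hp1, mul_zero]
    refine (hasDerivAt_const x (0 : ℝ)).congr_of_eventuallyEq ?_
    filter_upwards [Iio_mem_nhds hx] with y hy
    rw [max_eq_right (le_of_lt hy), Real.zero_rpow hp0]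
  · rw [max_self, ← hasDerivWithinAt_univ, ← Set.Iic_union_Ici (a := (0 : ℝ))]
    refine HasDerivWithinAt.union ?_ ?_
    · rw [Real.zero_rpow hp1, mul_zero]
      refine (hasDerivWithinAt_const (0 : ℝ) _ (0 : ℝ)).congr_of_mem (fun y hy => ?_) (by simp)
      rw [max_eq_right hy, Real.zero_rpow hp0]
    · refine (Real.hasDerivAt_rpow_const (Or.inr hp.le)).hasDerivWithinAt.congr_of_mem
        (fun y hy => ?_) (by simp)
      rw [max_eq_left hy]
  · rw [max_eq_left hx.le]
    refine (Real.hasDerivAt_rpow_const (Or.inl hx.ne')).congr_of_eventuallyEq ?_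
    filter_upwards [Ioi_mem_nhds hx] with y hy
    rw [max_eq_left (le_of_lt hy)]

theorem intervalIntegrable_sub_rpow_mul {β : ℝ} (hβ : 0 < β) {f : ℝ → ℝ} (hf : Continuous f)
    (y a b : ℝ) :
    IntervalIntegrable (fun s => (y - s) ^ (β - 1) * f s) volume a b := by
  have h : IntervalIntegrable (fun u : ℝ => u ^ (β - 1)) volume (y - a) (y - b) :=
    intervalIntegrable_rpow' (by linarith)
  have h' := h.comp_sub_left y
  simp only [sub_sub_cancel] at h'
  exact h'.mul_continuousOn hf.continuousOn

theorem integral_rpow_mul_sub_pow_three {β : ℝ} (hβ : 0 < β) {a : ℝ} (ha : 0 < a) :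
    ∫ u in (0 : ℝ)..a, u ^ (β - 1) * (a - u) ^ 3 =
      6 / (β * (β + 1) * (β + 2) * (β + 3)) * a ^ (β + 3) := by
  have hint : ∀ k : ℝ, 0 ≤ k →
      IntervalIntegrable (fun u : ℝ => u ^ (β - 1 + k)) volume 0 a :=
    fun k hk => intervalIntegrable_rpow' (by linarith)
  have hval : ∀ k : ℝ, 0 ≤ k →
      ∫ u in (0 : ℝ)..a, u ^ (β - 1 + k) = a ^ (β + k) / (β + k) := by
    intro k hk
    rw [integral_rpow (Or.inl (by linarith)), show β - 1 + k + 1 = β + k by ring,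
      Real.zero_rpow (by linarith), sub_zero]
  have hcongr : ∫ u in (0 : ℝ)..a, u ^ (β - 1) * (a - u) ^ 3 =
      ∫ u in (0 : ℝ)..a, (a ^ 3 * u ^ (β - 1 + 0) - 3 * a ^ 2 * u ^ (β - 1 + 1)
        + 3 * a * u ^ (β - 1 + 2) - u ^ (β - 1 + 3)) := by
    refine integral_congr_ae (Filter.Eventually.of_forall fun u hu => ?_)
    rw [Set.uIoc_of_le ha.le] at hu
    have hu0 := hu.1
    simp only [Real.rpow_add hu0, Real.rpow_zero, Real.rpow_one, Real.rpow_ofNat]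
    ring
  have h0 := (hint 0 le_rfl).const_mul (a ^ 3)
  have h1 := (hint 1 (by norm_num)).const_mul (3 * a ^ 2)
  have h2 := (hint 2 (by norm_num)).const_mul (3 * a)
  have h3 := hint 3 (by norm_num)
  rw [hcongr, intervalIntegral.integral_sub ((h0.sub h1).add h2) h3,
    intervalIntegral.integral_add (h0.sub h1) h2, intervalIntegral.integral_sub h0 h1]
  simp only [intervalIntegral.integral_const_mul]
  rw [hval 0 le_rfl, hval 1 (by norm_num), hval 2 (by norm_num), hval 3 (by norm_num)]
  simp only [Real.rpow_add ha, Real.rpow_one, Real.rpow_ofNat, add_zero]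
  field_simp
  ring

theorem integral_sub_rpow_mul_max_pow_three {β : ℝ} (hβ : 0 < β) {c y : ℝ} (hc : 0 ≤ c)
    (hy : 0 < y) :
    ∫ s in (0 : ℝ)..y, (y - s) ^ (β - 1) * (max (s - c) 0) ^ 3 =
      6 / (β * (β + 1) * (β + 2) * (β + 3)) * (max (y - c) 0) ^ (β + 3) := by
  have hzero : ∀ b : ℝ, 0 ≤ b → b ≤ c →
      ∫ s in (0 : ℝ)..b, (y - s) ^ (β - 1) * (max (s - c) 0) ^ 3 = 0 := by
    intro b hb hbc
    refine (integral_congr fun s hs => ?_).trans integral_zero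
    rw [Set.uIcc_of_le hb] at hs
    simp [max_eq_right (show s - c ≤ 0 by linarith [hs.2])]
  rcases le_or_gt y c with h | h
  · rw [hzero y hy.le h, max_eq_right (by linarith), Real.zero_rpow (by linarith), mul_zero]
  · have hint := intervalIntegrable_sub_rpow_mul hβ
      (f := fun s => (max (s - c) 0) ^ 3) (by fun_prop) y
    rw [← integral_add_adjacent_intervals (hint 0 c) (hint c y), hzero c hc le_rfl, zero_add,
      max_eq_left (by linarith), ← integral_rpow_mul_sub_pow_three hβ (sub_pos.2 h)]
    have hsub := integral_comp_sub_left (a := c) (b := y)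
      (fun u : ℝ => u ^ (β - 1) * (y - c - u) ^ 3) y
    rw [sub_self] at hsub
    rw [← hsub]
    refine integral_congr fun s hs => ?_
    rw [Set.uIcc_of_le h.le] at hs
    rw [max_eq_left (by linarith [hs.1])]
    ring

theorem stmt_16 (β : ℝ) (hβ : β ∈ Set.Ioo (0:ℝ) 1) (φ : ℝ → ℝ)
    (hφ : ∀ x : ℝ, φ x = (1 / 6) *
      ∑ i ∈ Finset.range 5, (Nat.choose 4 i : ℝ) * (-1) ^ i * (max (x - (i : ℝ)) 0) ^ 3) :
    ∀ x : ℝ, 0 < x →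
      HasDerivAt
        (fun y => (1 / Real.Gamma β) * ∫ s in (0:ℝ)..y, (y - s) ^ (β - 1) * φ s)
        ((1 / Real.Gamma (β + 3)) *
          ∑ i ∈ Finset.range 5,
            (Nat.choose 4 i : ℝ) * (-1) ^ i * (max (x - (i : ℝ)) 0) ^ (β + 2)) x := by
  intro x hx
  have hb : 0 < β := hβ.1
  have hΓ : Real.Gamma (β + 3) = (β + 2) * (β + 1) * β * Real.Gamma β := by
    rw [show β + 3 = β + 1 + 1 + 1 by ring, Real.Gamma_add_one (by linarith),
      Real.Gamma_add_one (by linarith), Real.Gamma_add_one hb.ne']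
    ring
  have hΓ0 : Real.Gamma β ≠ 0 := (Real.Gamma_pos_of_pos hb).ne'
  have hclosed : ∀ y : ℝ, 0 < y →
      (1 / Real.Gamma β) * ∫ s in (0:ℝ)..y, (y - s) ^ (β - 1) * φ s =
        (1 / Real.Gamma (β + 3)) * ∑ i ∈ Finset.range 5,
          (Nat.choose 4 i : ℝ) * (-1) ^ i * ((max (y - (i : ℝ)) 0) ^ (β + 3) / (β + 3)) := by
    intro y hy
    have hexp : ∀ s, (y - s) ^ (β - 1) * φ s = ∑ i ∈ Finset.range 5,
        ((1 / 6) * ((Nat.choose 4 i : ℝ) * (-1) ^ i)) *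
          ((y - s) ^ (β - 1) * (max (s - (i : ℝ)) 0) ^ 3) := by
      intro s
      rw [hφ, Finset.mul_sum, Finset.mul_sum]
      exact Finset.sum_congr rfl fun i _ => by ring
    simp_rw [hexp]
    rw [integral_finsetSum fun i _ =>
      (intervalIntegrable_sub_rpow_mul hb (by fun_prop) y 0 y).const_mul _,
      Finset.mul_sum, Finset.mul_sum]
    refine Finset.sum_congr rfl fun i _ => ?_
    rw [intervalIntegral.integral_const_mul, integral_sub_rpow_mul_max_pow_three hb i.cast_nonneg hy, hΓ]
    field_simp
  have hderiv : ∀ i : ℕ, HasDerivAt (fun y : ℝ => (max (y - (i : ℝ)) 0) ^ (β + 3) / (β + 3))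
      ((max (x - (i : ℝ)) 0) ^ (β + 2)) x := by
    intro i
    have h := ((hasDerivAt_max_zero_rpow (p := β + 3) (by linarith)
      (x - (i : ℝ))).comp_sub_const x (i : ℝ)).div_const (β + 3)
    rwa [mul_div_cancel_left₀ _ (by linarith : β + 3 ≠ 0),
      show β + 3 - 1 = β + 2 by ring] at h
  refine HasDerivAt.congr_of_eventuallyEq ?_
    (Filter.eventually_of_mem (Ioi_mem_nhds hx) fun y hy => hclosed y hy)
  exact (HasDerivAt.fun_sum fun i _ => (hderiv i).const_mul _).const_mul _
end
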